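/- arXiv:1309.3863 — 6 statements merged into one kernel-verified Lean document; each statement's English description precedes it below -/
import Mathlib

section
/- Let λ > 0 and μ > 0 and define ψ(ω) = √(1 − ω²)·√(1 − μω²/(λ + 2μ)) − (1 − ω²/2)² for ω ∈ [0, 1]. Then ψ(0) = 0, ψ(1) = −1/4, and there exists ω₀ ∈ (0, 1) with ψ(ω₀) = 0. -/
/-- The Rayleigh function `ψ(ω) = √(1−ω²)·√(1−μω²/(λ+2μ)) − (1−ω²/2)²` satisfies
`ψ(0) = 0`, `ψ(1) = −1/4`, and has a root `ω₀ ∈ (0,1)`. -/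
theorem rayleigh_function_values_and_root
    (lam mu : ℝ) (hlam : 0 < lam) (hmu : 0 < mu) :
    let ψ : ℝ → ℝ := fun ω =>
      Real.sqrt (1 - ω ^ 2) * Real.sqrt (1 - mu * ω ^ 2 / (lam + 2 * mu)) -
        (1 - ω ^ 2 / 2) ^ 2
    ψ 0 = 0 ∧ ψ 1 = -1 / 4 ∧ ∃ ω₀ ∈ Set.Ioo (0 : ℝ) 1, ψ ω₀ = 0 := by
  intro ψ
  have zero : ψ 0 = 0 := by simp [ψ]
  have one : ψ 1 = -1 / 4 := by norm_num [ψ]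
  have half : 0 < ψ (1 / 2) := by
    have ratio : mu * (1 / 2) ^ 2 / (lam + 2 * mu) ≤ 1 / 8 := by
      rw [div_le_iff₀ (by positivity)]
      linarith
    have lower : (7 / 8 : ℝ) ^ 2 <
        Real.sqrt ((1 - (1 / 2) ^ 2) * (1 - mu * (1 / 2) ^ 2 / (lam + 2 * mu))) := by
      apply Real.lt_sqrt_of_sq_lt
      linarith
    rw [Real.sqrt_mul (by norm_num)] at lower
    simp only [ψ]
    linarith
  have cont : Continuous ψ := by
    dsimp only [ψ]
    fun_prop
  refine ⟨zero, one, ?_⟩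
  obtain ⟨ω, hω, root⟩ := intermediate_value_Ioo' (by norm_num : (1 / 2 : ℝ) ≤ 1)
    cont.continuousOn (show (0 : ℝ) ∈ Set.Ioo (ψ 1) (ψ (1 / 2)) from
      ⟨by rw [one]; norm_num, half⟩)
  exact ⟨ω, ⟨by linarith [hω.1], hω.2⟩, root⟩
end

section
/- Let λ > 0 and μ > 0 and define ψ(ω) = √(1 − ω²)·√(1 − μω²/(λ + 2μ)) − (1 − ω²/2)² for ω ∈ [0, 1]. Then there is exactly one ω₀ ∈ (0, 1) with ψ(ω₀) = 0; that is, if ω₁, ω₂ ∈ (0,1) satisfy ψ(ω₁) = ψ(ω₂) = 0 then ω₁ = ω₂. -/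
/-- Squaring reduces the Rayleigh equation, with `a` the squared ratio of the wave speeds and
`x = ω²`, to a cubic equation after removal of the root `x = 0`. -/
theorem rayleigh_eq_zero_iff_cubic {a x : ℝ} (ha : a < 1) (hx : 0 < x) (hx1 : x < 1) :
    Real.sqrt (1 - x) * Real.sqrt (1 - a * x) - (1 - x / 2) ^ 2 = 0 ↔
      (1 - a) + (a - 3 / 2) * x + x ^ 2 / 2 - x ^ 3 / 16 = 0 := by
  have h1 : 0 ≤ 1 - x := by linarith
  have h2 : 0 ≤ 1 - a * x := by nlinarith
  rw [← Real.sqrt_mul h1, sub_eq_zero, Real.sqrt_eq_iff_mul_self_eq (mul_nonneg h1 h2)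
    (sq_nonneg _), ← mul_right_inj' hx.ne' (c := 0)]
  constructor <;> intro h <;> linarith

/-- The reduced Rayleigh cubic is injective on `(0,1)`. -/
theorem rayleigh_cubic_injOn {a : ℝ} (ha : a < 1 / 2) :
    Set.InjOn (fun x : ℝ => (1 - a) + (a - 3 / 2) * x + x ^ 2 / 2 - x ^ 3 / 16)
      (Set.Ioo 0 1) := by
  rintro x ⟨hx, hx1⟩ y ⟨hy, hy1⟩ h
  have hfac : (x - y) *
      ((a - 3 / 2) + (x + y) / 2 - (x ^ 2 + x * y + y ^ 2) / 16) = 0 := by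
    linear_combination h
  have hneg : (a - 3 / 2) + (x + y) / 2 - (x ^ 2 + x * y + y ^ 2) / 16 < 0 := by
    have : 0 < x ^ 2 + x * y + y ^ 2 := by positivity
    linarith
  exact sub_eq_zero.mp ((mul_eq_zero.mp hfac).resolve_right hneg.ne)

/-- The reduced Rayleigh cubic has a root in `(0,1)`. -/
theorem exists_rayleigh_cubic_eq_zero {a : ℝ} (ha : a < 1) :
    ∃ x ∈ Set.Ioo (0 : ℝ) 1, (1 - a) + (a - 3 / 2) * x + x ^ 2 / 2 - x ^ 3 / 16 = 0 := by
  have hcont : ContinuousOn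
      (fun x : ℝ => (1 - a) + (a - 3 / 2) * x + x ^ 2 / 2 - x ^ 3 / 16) (Set.Icc 0 1) := by
    fun_prop
  exact intermediate_value_Ioo' zero_le_one hcont ⟨by norm_num, by norm_num; linarith⟩

/-- The Rayleigh function `ψ(ω) = √(1−ω²)·√(1−μω²/(λ+2μ)) − (1−ω²/2)²` has exactly one
root in `(0,1)`: in particular any two roots `ω₁, ω₂ ∈ (0,1)` coincide. -/
theorem rayleigh_function_unique_root
    (lam mu : ℝ) (hlam : 0 < lam) (hmu : 0 < mu) :
    let ψ : ℝ → ℝ := fun ω =>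
      Real.sqrt (1 - ω ^ 2) * Real.sqrt (1 - mu * ω ^ 2 / (lam + 2 * mu)) -
        (1 - ω ^ 2 / 2) ^ 2
    ∃! ω₀ : ℝ, ω₀ ∈ Set.Ioo (0 : ℝ) 1 ∧ ψ ω₀ = 0 := by
  intro ψ
  have ha : mu / (lam + 2 * mu) < 1 / 2 := by
    rw [div_lt_div_iff₀ (by positivity) two_pos]
    linarith
  have hsq : ∀ ω ∈ Set.Ioo (0 : ℝ) 1, ω ^ 2 ∈ Set.Ioo (0 : ℝ) 1 := fun ω hω =>
    ⟨pow_pos hω.1 2, pow_lt_one₀ hω.1.le hω.2 two_ne_zero⟩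
  have hψ : ∀ ω, ω ^ 2 ∈ Set.Ioo (0 : ℝ) 1 → (ψ ω = 0 ↔ _) := fun ω hω => by
    simp only [ψ, mul_div_right_comm]
    exact rayleigh_eq_zero_iff_cubic (by linarith) hω.1 hω.2
  obtain ⟨x, hx, hroot⟩ := exists_rayleigh_cubic_eq_zero (a := mu / (lam + 2 * mu)) (by linarith)
  have hsx : Real.sqrt x ^ 2 = x := Real.sq_sqrt hx.1.le
  refine ⟨Real.sqrt x, ⟨⟨Real.sqrt_pos.mpr hx.1, ?_⟩, ?_⟩, ?_⟩
  · exact (Real.sqrt_lt' one_pos).mpr (by simpa using hx.2)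
  · rw [hψ _ (by rwa [hsx]), hsx]
    exact hroot
  · rintro ω ⟨hω, hω0⟩
    have h := rayleigh_cubic_injOn ha (hsq ω hω) hx
      (((hψ ω (hsq ω hω)).mp hω0).trans hroot.symm)
    rw [← h, Real.sqrt_sq hω.1.le]
end

section
/- Let λ > 0 and μ > 0 and define ψ(ω) = √(1 − ω²)·√(1 − μω²/(λ + 2μ)) − (1 − ω²/2)² for ω ∈ [0, 1]. Then ψ(ω)/ω² tends to (λ + μ)/(2(λ + 2μ)) as ω → 0⁺; in particular (λ + μ)/(2(λ + 2μ)) > 0, so ψ(ω) > 0 for all sufficiently small ω > 0. -/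
/-- The Rayleigh function, as a function of `t = ω²` and with `k = μ/(λ+2μ)`, has derivative
`(1 - k)/2` at the origin. -/
theorem hasDerivAt_rayleigh_zero (k : ℝ) :
    HasDerivAt (fun t : ℝ => √(1 - t) * √(1 - k * t) - (1 - t / 2) ^ 2) ((1 - k) / 2) 0 := by
  have h₁ : HasDerivAt (fun t : ℝ => √(1 - t)) (-1 / (2 * √(1 - 0))) 0 :=
    ((hasDerivAt_id (0 : ℝ)).const_sub 1).sqrt (by norm_num)
  have h₂ : HasDerivAt (fun t : ℝ => √(1 - k * t)) (-(k * 1) / (2 * √(1 - k * 0))) 0 :=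
    (((hasDerivAt_id (0 : ℝ)).const_mul k).const_sub 1).sqrt (by norm_num)
  have h₃ : HasDerivAt (fun t : ℝ => (1 - t / 2) ^ 2) _ 0 :=
    (((hasDerivAt_id (0 : ℝ)).div_const 2).const_sub 1).pow 2
  refine ((h₁.mul h₂).sub h₃).congr_deriv ?_
  norm_num
  ring

/-- As `ω → 0⁺`, `ψ(ω)/ω² → (λ+μ)/(2(λ+2μ)) > 0`, hence `ψ(ω) > 0` for all
sufficiently small `ω > 0`. -/
theorem rayleigh_function_positive_near_zero
    (lam mu : ℝ) (hlam : 0 < lam) (hmu : 0 < mu) :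
    let ψ : ℝ → ℝ := fun ω =>
      Real.sqrt (1 - ω ^ 2) * Real.sqrt (1 - mu * ω ^ 2 / (lam + 2 * mu)) -
        (1 - ω ^ 2 / 2) ^ 2
    Filter.Tendsto (fun ω => ψ ω / ω ^ 2) (nhdsWithin 0 (Set.Ioi 0))
        (nhds ((lam + mu) / (2 * (lam + 2 * mu)))) ∧
      0 < (lam + mu) / (2 * (lam + 2 * mu)) ∧
      ∀ᶠ ω in nhdsWithin 0 (Set.Ioi 0), 0 < ψ ω := by
  intro ψ
  have hpos : 0 < (lam + mu) / (2 * (lam + 2 * mu)) := by positivity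
  have hsq : Filter.Tendsto (fun ω : ℝ => ω ^ 2) (nhdsWithin 0 (Set.Ioi 0))
      (nhdsWithin 0 {0}ᶜ) := by
    refine tendsto_nhdsWithin_iff.2 ⟨?_, ?_⟩
    · exact ((continuous_pow 2).tendsto' (0 : ℝ) 0 (by norm_num)).mono_left nhdsWithin_le_nhds
    · filter_upwards [self_mem_nhdsWithin] with ω (hω : 0 < ω)
      exact (pow_pos hω 2).ne'
  have hlim : Filter.Tendsto (fun ω => ψ ω / ω ^ 2) (nhdsWithin 0 (Set.Ioi 0))
      (nhds ((lam + mu) / (2 * (lam + 2 * mu)))) := by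
    have h := (hasDerivAt_rayleigh_zero (mu / (lam + 2 * mu))).tendsto_slope.comp hsq
    convert h using 2
    · simp [ψ, slope_def_field, div_mul_eq_mul_div]
    · field_simp
      ring
  refine ⟨hlim, hpos, ?_⟩
  filter_upwards [hlim.eventually_const_lt hpos, self_mem_nhdsWithin] with ω h (hω : 0 < ω)
  exact (div_pos_iff_of_pos_right (pow_pos hω 2)).1 h
end

section
/- Let λ > 0 and μ > 0 and define ψ(ω) = √(1 − ω²)·√(1 − μω²/(λ + 2μ)) − (1 − ω²/2)² for ω ∈ [0, 1]. If ω₀ ∈ (0, 1) satisfies ψ(ω₀) = 0, then the derivative ψ′(ω₀) is nonzero. -/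
/-- The squared Rayleigh equation `(1 - x) (1 - k x) = (1 - x / 2) ^ 4` has no double root in
`(0, 1)` when `k < 1 / 2`. -/
theorem rayleigh_polynomial_deriv_ne_zero {k x : ℝ} (hk : k < 1 / 2) (hx₀ : 0 < x) (hx₁ : x < 1)
    (hroot : (1 - x) * (1 - k * x) = (1 - x / 2) ^ 4) :
    -(1 - k * x) - k * (1 - x) + 2 * (1 - x / 2) ^ 3 ≠ 0 := by
  intro hderiv
  have hg : (1 - k) - (3 / 2 - k) * x + x ^ 2 / 2 - x ^ 3 / 16 = 0 := by
    apply mul_left_cancel₀ hx₀.ne'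
    linear_combination hroot
  have hg' : -(3 / 2 - k) + x - 3 * x ^ 2 / 16 = 0 := by
    apply mul_left_cancel₀ hx₀.ne'
    linear_combination hderiv - hg
  nlinarith [sq_nonneg x]

/-- At any root `ω₀ ∈ (0,1)` of the Rayleigh function
`ψ(ω) = √(1−ω²)·√(1−μω²/(λ+2μ)) − (1−ω²/2)²`, the derivative `ψ′(ω₀)` is nonzero. -/
theorem rayleigh_function_deriv_ne_zero_at_root
    (lam mu ω₀ : ℝ) (hlam : 0 < lam) (hmu : 0 < mu)
    (hω₀ : ω₀ ∈ Set.Ioo (0 : ℝ) 1)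
    (hroot : Real.sqrt (1 - ω₀ ^ 2) * Real.sqrt (1 - mu * ω₀ ^ 2 / (lam + 2 * mu)) -
        (1 - ω₀ ^ 2 / 2) ^ 2 = 0) :
    deriv (fun ω : ℝ =>
        Real.sqrt (1 - ω ^ 2) * Real.sqrt (1 - mu * ω ^ 2 / (lam + 2 * mu)) -
          (1 - ω ^ 2 / 2) ^ 2) ω₀ ≠ 0 := by
  obtain ⟨hpos, hlt⟩ := hω₀
  have hx₀ : 0 < ω₀ ^ 2 := by positivity
  have hx₁ : ω₀ ^ 2 < 1 := by nlinarith
  obtain ⟨k, hk⟩ : ∃ k, k = mu / (lam + 2 * mu) := ⟨_, rfl⟩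
  have hk₁ : k < 1 / 2 := by
    rw [hk, div_lt_div_iff₀ (by positivity) two_pos]
    linarith
  have hquot : ∀ ω : ℝ, mu * ω ^ 2 / (lam + 2 * mu) = k * ω ^ 2 := fun ω => by
    rw [hk, mul_div_right_comm]
  simp only [hquot] at hroot ⊢
  have ha : 0 < 1 - ω₀ ^ 2 := by linarith
  have hb : 0 < 1 - k * ω₀ ^ 2 := by nlinarith
  have hsq : HasDerivAt (fun ω : ℝ => ω ^ 2) (2 * ω₀) ω₀ := by
    simpa using hasDerivAt_pow 2 ω₀
  have hA := (hsq.const_sub 1).sqrt ha.ne'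
  have hB := ((hsq.const_mul k).const_sub 1).sqrt hb.ne'
  have hC := ((hsq.div_const 2).const_sub 1).pow 2
  have hψ : HasDerivAt
      (fun ω : ℝ => Real.sqrt (1 - ω ^ 2) * Real.sqrt (1 - k * ω ^ 2) - (1 - ω ^ 2 / 2) ^ 2)
      _ ω₀ := (hA.mul hB).sub hC
  rw [hψ.deriv]
  have hA₀ := Real.sqrt_pos.2 ha
  have hB₀ := Real.sqrt_pos.2 hb
  have hA₂ := Real.sq_sqrt ha.le
  have hB₂ := Real.sq_sqrt hb.le
  generalize Real.sqrt (1 - ω₀ ^ 2) = A at *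
  generalize Real.sqrt (1 - k * ω₀ ^ 2) = B at *
  have hAB : A * B = (1 - ω₀ ^ 2 / 2) ^ 2 := sub_eq_zero.1 hroot
  intro h
  refine rayleigh_polynomial_deriv_ne_zero hk₁ hx₀ hx₁ ?_ ?_
  · rw [← hA₂, ← hB₂, ← mul_pow, hAB]
    ring
  · have hnum : -B ^ 2 - k * A ^ 2 + 2 * (1 - ω₀ ^ 2 / 2) * (A * B) = 0 := by
      apply mul_left_cancel₀ hpos.ne'
      field_simp at h
      push_cast at h
      linear_combination h
    linear_combination hnum + hB₂ + k * hA₂ - 2 * (1 - ω₀ ^ 2 / 2) * hAB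
end

section
/- There exists a constant c > 0 such that for all Lamé parameters λ > 0 and μ > 0, every root ω₀ ∈ (0, 1) of ψ(ω) = √(1 − ω²)·√(1 − μω²/(λ + 2μ)) − (1 − ω²/2)² satisfies |ψ′(ω₀)| ≥ c; that is, the derivative of the Rayleigh function at its nonzero root is bounded away from zero uniformly in the ratio μ/λ. -/
theorem hasDerivAt_rayleigh {g w : ℝ} (ha : 0 < 1 - w ^ 2) (hb : 0 < 1 - g * w ^ 2) :
    HasDerivAt (fun ω : ℝ => √(1 - ω ^ 2) * √(1 - g * ω ^ 2) - (1 - ω ^ 2 / 2) ^ 2)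
      (-w / √(1 - w ^ 2) * √(1 - g * w ^ 2) + √(1 - w ^ 2) * (-g * w / √(1 - g * w ^ 2))
        + 2 * w * (1 - w ^ 2 / 2)) w := by
  have hsq : HasDerivAt (fun ω : ℝ => ω ^ 2) (2 * w) w := by
    simpa using hasDerivAt_pow 2 w
  refine ((((hsq.const_sub 1).sqrt ha.ne').mul (((hsq.const_mul g).const_sub 1).sqrt hb.ne')).sub
    (((hsq.div_const 2).const_sub 1).pow 2)).congr_deriv ?_
  have ha' := (Real.sqrt_pos.2 ha).ne'
  have hb' := (Real.sqrt_pos.2 hb).ne'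
  generalize √(1 - w ^ 2) = a at *
  generalize √(1 - g * w ^ 2) = b at *
  field_simp
  ring

/-- The Rayleigh cubic vanishes at the square of a nonzero root of the Rayleigh function. -/
theorem rayleigh_cubic_eq_zero {g w : ℝ} (hw : w ≠ 0) (ha : 0 < 1 - w ^ 2)
    (hb : 0 < 1 - g * w ^ 2)
    (h : √(1 - w ^ 2) * √(1 - g * w ^ 2) = (1 - w ^ 2 / 2) ^ 2) :
    1 - g - (3 / 2 - g) * w ^ 2 + w ^ 4 / 2 - w ^ 6 / 16 = 0 := by
  have h2 : (1 - w ^ 2) * (1 - g * w ^ 2) = ((1 - w ^ 2 / 2) ^ 2) ^ 2 := by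
    rw [← h, mul_pow, Real.sq_sqrt ha.le, Real.sq_sqrt hb.le]
  refine (mul_eq_zero.1 ?_).resolve_left (pow_ne_zero 2 hw)
  linear_combination h2

theorem abs_deriv_rayleigh_ge {g w : ℝ} (hg0 : 0 < g) (hg : g < 1 / 2) (hw0 : 0 < w) (hw1 : w < 1)
    (h : √(1 - w ^ 2) * √(1 - g * w ^ 2) = (1 - w ^ 2 / 2) ^ 2) :
    1 / 144 ≤ |deriv (fun ω : ℝ => √(1 - ω ^ 2) * √(1 - g * ω ^ 2) - (1 - ω ^ 2 / 2) ^ 2) w| := by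
  have hx0 : 0 < w ^ 2 := by positivity
  have hx1 : w ^ 2 < 1 := by nlinarith
  have ha : 0 < 1 - w ^ 2 := by linarith
  have hb : 0 < 1 - g * w ^ 2 := by nlinarith
  have hR := rayleigh_cubic_eq_zero hw0.ne' ha hb h
  rw [(hasDerivAt_rayleigh ha hb).deriv]
  set D := -w / √(1 - w ^ 2) * √(1 - g * w ^ 2) + √(1 - w ^ 2) * (-g * w / √(1 - g * w ^ 2))
    + 2 * w * (1 - w ^ 2 / 2) with hD
  have key : D * (1 - w ^ 2 / 2) ^ 2
      = -(w ^ 3 * (3 / 2 - g - w ^ 2 + 3 * w ^ 4 / 16)) := by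
    have hmul : D * (√(1 - w ^ 2) * √(1 - g * w ^ 2)) = -w * √(1 - g * w ^ 2) ^ 2
        - g * w * √(1 - w ^ 2) ^ 2
        + 2 * w * (1 - w ^ 2 / 2) * (√(1 - w ^ 2) * √(1 - g * w ^ 2)) := by
      have ha' := (Real.sqrt_pos.2 ha).ne'
      have hb' := (Real.sqrt_pos.2 hb).ne'
      rw [hD]
      generalize √(1 - w ^ 2) = a at ha' ⊢
      generalize √(1 - g * w ^ 2) = b at hb' ⊢
      field_simp
      ring
    rw [Real.sq_sqrt ha.le, Real.sq_sqrt hb.le, h] at hmul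
    linear_combination hmul + w * hR
  have hthird : 1 / 3 ≤ w ^ 2 := by
    have h64 : w ^ 6 ≤ w ^ 4 := pow_le_pow_of_le_one hw0.le hw1.le (by norm_num)
    have h4 : 0 < w ^ 4 := by positivity
    nlinarith
  have hw : 1 / 3 ≤ w := by nlinarith
  have hcube : 1 / 27 ≤ w ^ 3 := by
    have := pow_le_pow_left₀ (by norm_num : (0 : ℝ) ≤ 1 / 3) hw 3
    linarith
  have hslope : 3 / 16 ≤ 3 / 2 - g - w ^ 2 + 3 * w ^ 4 / 16 := by
    nlinarith [mul_pos ha ha]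
  have hprod : 1 / 27 * (3 / 16) ≤ w ^ 3 * (3 / 2 - g - w ^ 2 + 3 * w ^ 4 / 16) := by
    gcongr
  have ht : (1 - w ^ 2 / 2) ^ 2 ≤ 1 := pow_le_one₀ (by linarith) (by linarith)
  calc (1 / 144 : ℝ) ≤ |D * (1 - w ^ 2 / 2) ^ 2| := by
        rw [key, abs_neg]
        exact le_trans (by linarith) (le_abs_self _)
    _ = |D| * (1 - w ^ 2 / 2) ^ 2 := by rw [abs_mul, abs_sq]
    _ ≤ |D| := mul_le_of_le_one_right (abs_nonneg _) ht

/-- The derivative of the Rayleigh function at its root in `(0,1)` is bounded away from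
zero uniformly in the Lamé parameters `λ, μ > 0`. -/
theorem rayleigh_function_deriv_uniformly_bounded_below :
    ∃ c > 0, ∀ lam mu : ℝ, 0 < lam → 0 < mu →
      ∀ ω₀ ∈ Set.Ioo (0 : ℝ) 1,
        Real.sqrt (1 - ω₀ ^ 2) * Real.sqrt (1 - mu * ω₀ ^ 2 / (lam + 2 * mu)) -
            (1 - ω₀ ^ 2 / 2) ^ 2 = 0 →
          c ≤ |deriv (fun ω : ℝ =>
              Real.sqrt (1 - ω ^ 2) * Real.sqrt (1 - mu * ω ^ 2 / (lam + 2 * mu)) -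
                (1 - ω ^ 2 / 2) ^ 2) ω₀| := by
  refine ⟨1 / 144, by norm_num, fun lam mu hlam hmu w hw h => ?_⟩
  simp only [mul_div_right_comm mu _ (lam + 2 * mu)] at h ⊢
  have hg : mu / (lam + 2 * mu) < 1 / 2 := by
    rw [div_lt_div_iff₀ (by positivity) (by norm_num)]
    linarith
  exact abs_deriv_rayleigh_ge (by positivity) hg hw.1 hw.2 (sub_eq_zero.1 h)
end

section
/- Let λ > 0, μ > 0, ξ > 0, c > 0, α > 0, β > 0 with α² = ξ² − c²ξ²/(λ + 2μ) and β² = ξ² − c²ξ²/μ, and let A be a real constant. Define u(x, y, t) = A·(−ξ·e^{−αy} + ((β² + ξ²)/(2ξ))·e^{−βy})·sin(ξ(x − ct)) and v(x, y, t) = A·(−α·e^{−αy} + ((β² + ξ²)/(2β))·e^{−βy})·cos(ξ(x − ct)). Then u and v satisfy the elastic wave system u_tt = μ(u_xx + u_yy) + (λ + μ)∂_x(u_x + v_y) and v_tt = μ(v_xx + v_yy) + (λ + μ)∂_y(u_x + v_y) at every point (x, y, t). -/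
theorem deriv_mul_sin_wave_space (C ξ d x : ℝ) :
    deriv (fun x' => C * Real.sin (ξ * (x' - d))) x = C * ξ * Real.cos (ξ * (x - d)) := by
  have h : HasDerivAt (fun x' => ξ * (x' - d)) (ξ * 1) x :=
    ((hasDerivAt_id' x).sub_const d).const_mul ξ
  rw [(h.sin.const_mul C).deriv]
  ring

theorem deriv_mul_cos_wave_space (C ξ d x : ℝ) :
    deriv (fun x' => C * Real.cos (ξ * (x' - d))) x = -(C * ξ) * Real.sin (ξ * (x - d)) := by
  have h : HasDerivAt (fun x' => ξ * (x' - d)) (ξ * 1) x :=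
    ((hasDerivAt_id' x).sub_const d).const_mul ξ
  rw [(h.cos.const_mul C).deriv]
  ring

theorem deriv_mul_sin_wave_time (C ξ x c t : ℝ) :
    deriv (fun t' => C * Real.sin (ξ * (x - c * t'))) t =
      -(C * ξ * c) * Real.cos (ξ * (x - c * t)) := by
  have h : HasDerivAt (fun t' => ξ * (x - c * t')) (ξ * -(c * 1)) t :=
    (((hasDerivAt_id' t).const_mul c).const_sub x).const_mul ξ
  rw [(h.sin.const_mul C).deriv]
  ring

theorem deriv_mul_cos_wave_time (C ξ x c t : ℝ) :
    deriv (fun t' => C * Real.cos (ξ * (x - c * t'))) t =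
      C * ξ * c * Real.sin (ξ * (x - c * t)) := by
  have h : HasDerivAt (fun t' => ξ * (x - c * t')) (ξ * -(c * 1)) t :=
    (((hasDerivAt_id' t).const_mul c).const_sub x).const_mul ξ
  rw [(h.cos.const_mul C).deriv]
  ring

theorem deriv_exp_profile (A P α Q β S y : ℝ) :
    deriv (fun y' => A * (P * Real.exp (-α * y') + Q * Real.exp (-β * y')) * S) y =
      A * (-(P * α) * Real.exp (-α * y) + -(Q * β) * Real.exp (-β * y)) * S := by
  have h (a : ℝ) : HasDerivAt (fun y' => -a * y') (-a * 1) y :=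
    (hasDerivAt_id' y).const_mul (-a)
  have hE := ((((h α).exp.const_mul P).add ((h β).exp.const_mul Q)).const_mul A).mul_const S
  refine hE.deriv.trans ?_
  ring


/-- The Rayleigh surface-wave displacement field
`u = A(−ξe^{−αy} + ((β²+ξ²)/(2ξ))e^{−βy})·sin(ξ(x−ct))`,
`v = A(−αe^{−αy} + ((β²+ξ²)/(2β))e^{−βy})·cos(ξ(x−ct))`
satisfies the two-dimensional elastic wave system
`u_tt = μΔu + (λ+μ)∂ₓ(uₓ+v_y)`, `v_tt = μΔv + (λ+μ)∂_y(uₓ+v_y)`. -/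
theorem rayleigh_wave_satisfies_elastic_system
    (lam mu ξ c α β A : ℝ) (hlam : 0 < lam) (hmu : 0 < mu)
    (hξ : 0 < ξ) (hc : 0 < c) (hα : 0 < α) (hβ : 0 < β)
    (hα2 : α ^ 2 = ξ ^ 2 - c ^ 2 * ξ ^ 2 / (lam + 2 * mu))
    (hβ2 : β ^ 2 = ξ ^ 2 - c ^ 2 * ξ ^ 2 / mu) :
    let u : ℝ → ℝ → ℝ → ℝ := fun x y t =>
      A * (-ξ * Real.exp (-α * y) + (β ^ 2 + ξ ^ 2) / (2 * ξ) * Real.exp (-β * y)) *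
        Real.sin (ξ * (x - c * t))
    let v : ℝ → ℝ → ℝ → ℝ := fun x y t =>
      A * (-α * Real.exp (-α * y) + (β ^ 2 + ξ ^ 2) / (2 * β) * Real.exp (-β * y)) *
        Real.cos (ξ * (x - c * t))
    ∀ x y t : ℝ,
      (deriv (fun t' => deriv (fun t'' => u x y t'') t') t =
        mu * (deriv (fun x' => deriv (fun x'' => u x'' y t) x') x +
              deriv (fun y' => deriv (fun y'' => u x y'' t) y') y) +
        (lam + mu) * deriv (fun x' =>
            deriv (fun x'' => u x'' y t) x' + deriv (fun y' => v x' y' t) y) x) ∧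
      (deriv (fun t' => deriv (fun t'' => v x y t'') t') t =
        mu * (deriv (fun x' => deriv (fun x'' => v x'' y t) x') x +
              deriv (fun y' => deriv (fun y'' => v x y'' t) y') y) +
        (lam + mu) * deriv (fun y' =>
            deriv (fun x' => u x' y' t) x + deriv (fun y'' => v x y'' t) y') y) := by
  intro u v x y t
  have hα2' : c ^ 2 * ξ ^ 2 = (lam + 2 * mu) * (ξ ^ 2 - α ^ 2) := by
    rw [hα2]; field_simp; ring
  have hβ2' : c ^ 2 * ξ ^ 2 = mu * (ξ ^ 2 - β ^ 2) := by
    rw [hβ2]; field_simp; ring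
  have hdiv (x y : ℝ) :
      deriv (fun x' => u x' y t) x + deriv (fun y' => v x y' t) y =
        A * ((α ^ 2 - ξ ^ 2) * Real.exp (-α * y) + 0 * Real.exp (-β * y)) *
          Real.cos (ξ * (x - c * t)) := by
    simp only [u, v, deriv_mul_sin_wave_space, deriv_exp_profile]
    field_simp
    ring
  simp only [hdiv]
  simp only [u, v, deriv_mul_sin_wave_space, deriv_mul_cos_wave_space,
    deriv_mul_sin_wave_time, deriv_mul_cos_wave_time, deriv_exp_profile]
  constructor
  · linear_combination
      A * ξ * Real.exp (-α * y) * Real.sin (ξ * (x - c * t)) * hα2' -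
        A * ((β ^ 2 + ξ ^ 2) / (2 * ξ)) * Real.exp (-β * y) *
          Real.sin (ξ * (x - c * t)) * hβ2'
  · linear_combination
      A * α * Real.exp (-α * y) * Real.cos (ξ * (x - c * t)) * hα2' -
        A * ((β ^ 2 + ξ ^ 2) / (2 * β)) * Real.exp (-β * y) *
          Real.cos (ξ * (x - c * t)) * hβ2'
end
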